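/- Let d and k be positive integers, let φ : {1,…,k} → ℝ^d satisfy ‖φ_i‖₂ ≤ 1 for all i, and define Λ_j = I + Σ_{i=1}^{j} φ_i φ_iᵀ for 0 ≤ j ≤ k. Then Σ_{i=1}^{k} sqrt( φ_iᵀ (Λ_{i-1})⁻¹ φ_i ) ≤ sqrt( 2 d k · log( k/d + 1 ) ). -/

import Mathlib

open Matrix BigOperators

/-- The regularized Gram matrix `Λ_j = I + ∑_{i=1}^{j} φ_i φ_iᵀ`. -/
noncomputable def gramMat (d k : ℕ) (φ : Fin k → Fin d → ℝ) (j : ℕ) :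
    Matrix (Fin d) (Fin d) ℝ :=
  1 + ∑ i : Fin k, if (i : ℕ) < j then vecMulVec (φ i) (φ i) else 0

lemma gram_succ (d k : ℕ) (φ : Fin k → Fin d → ℝ) (i : Fin k) :
    gramMat d k φ ((i : ℕ) + 1) = gramMat d k φ (i : ℕ) + vecMulVec (φ i) (φ i) := by
  unfold gramMat
  rw [add_assoc]
  congr 1
  have h : vecMulVec (φ i) (φ i) =
      ∑ j : Fin k, if j = i then vecMulVec (φ j) (φ j) else 0 := by simp
  rw [h, ← Finset.sum_add_distrib]
  refine Finset.sum_congr rfl fun j _ => ?_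
  rcases lt_trichotomy j i with hj | hj | hj
  · have h1 : (j : ℕ) < i := hj
    simp [h1, hj.ne, Nat.lt_succ_of_lt h1]
  · subst hj; simp
  · have h1 : (i : ℕ) < j := hj
    have h2 : ¬ (j : ℕ) < i + 1 := by omega
    have h3 : ¬ (j : ℕ) < i := by omega
    rw [if_neg h2, if_neg h3, if_neg hj.ne', add_zero]

lemma gram_rest (d k : ℕ) (φ : Fin k → Fin d → ℝ) (j : ℕ) :
    (∑ i : Fin k, if (i : ℕ) < j then vecMulVec (φ i) (φ i) else 0).PosSemidef := by
  refine Matrix.posSemidef_sum _ fun i _ => ?_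
  split_ifs
  · simpa using Matrix.posSemidef_vecMulVec_self_star (φ i)
  · exact Matrix.PosSemidef.zero

lemma gram_posDef (d k : ℕ) (φ : Fin k → Fin d → ℝ) (j : ℕ) :
    (gramMat d k φ j).PosDef :=
  Matrix.PosDef.one.add_posSemidef (gram_rest d k φ j)

lemma gram_det_succ (d k : ℕ) (φ : Fin k → Fin d → ℝ) (i : Fin k) :
    (gramMat d k φ ((i : ℕ) + 1)).det = (gramMat d k φ (i : ℕ)).det *
      (1 + φ i ⬝ᵥ (gramMat d k φ (i : ℕ))⁻¹.mulVec (φ i)) := by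
  rw [gram_succ, vecMulVec_eq Unit, det_add_replicateCol_mul_replicateRow
    (gram_posDef d k φ i).det_pos.ne'.isUnit]
  congr 1
  rw [det_unique]
  simp [Matrix.mul_assoc, Matrix.mul_apply, dotProduct, mulVec]

lemma gram_x (d k : ℕ) (φ : Fin k → Fin d → ℝ) (j : ℕ) (v : Fin d → ℝ)
    (hv : ∑ i, v i ^ 2 ≤ 1) :
    0 ≤ v ⬝ᵥ (gramMat d k φ j)⁻¹.mulVec v ∧ v ⬝ᵥ (gramMat d k φ j)⁻¹.mulVec v ≤ 1 := by
  set y := (gramMat d k φ j)⁻¹.mulVec v with hy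
  have hvy : v = (gramMat d k φ j).mulVec y := by
    rw [hy, mulVec_mulVec, mul_nonsing_inv _ (gram_posDef d k φ j).det_pos.ne'.isUnit, one_mulVec]
  have h1 : ∑ i, y i ^ 2 ≤ v ⬝ᵥ y := by
    have := (gram_rest d k φ j).dotProduct_mulVec_nonneg y
    rw [dotProduct_comm, hvy]
    unfold gramMat
    rw [add_mulVec, one_mulVec, dotProduct_add]
    simp only [star_trivial] at this
    have h2 : y ⬝ᵥ y = ∑ i, y i ^ 2 := by simp [dotProduct, sq]
    linarith
  have h0 : 0 ≤ ∑ i, y i ^ 2 := Finset.sum_nonneg fun i _ => sq_nonneg _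
  have h3 : (v ⬝ᵥ y) ^ 2 ≤ (∑ i, v i ^ 2) * ∑ i, y i ^ 2 :=
    Finset.sum_mul_sq_le_sq_mul_sq _ _ _
  refine ⟨h0.trans h1, ?_⟩
  nlinarith [mul_le_mul_of_nonneg_right hv h0]

lemma gram_trace (d k : ℕ) (φ : Fin k → Fin d → ℝ) (hφ : ∀ i, ∑ j, φ i j ^ 2 ≤ 1) :
    (gramMat d k φ k).trace ≤ d + k := by
  unfold gramMat
  rw [trace_add, trace_one, trace_sum, Fintype.card_fin]
  have : ∑ i : Fin k, (if (i : ℕ) < k then vecMulVec (φ i) (φ i) else 0).trace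
      ≤ ∑ i : Fin k, (1 : ℝ) := by
    refine Finset.sum_le_sum fun i _ => ?_
    rw [if_pos i.2]
    have h := hφ i
    simpa [trace, vecMulVec_apply, sq] using h
  simp only [Finset.sum_const, Finset.card_univ, Fintype.card_fin, nsmul_eq_mul, mul_one] at this
  linarith

lemma gram_logdet (d k : ℕ) (hd : 0 < d) (φ : Fin k → Fin d → ℝ)
    (hφ : ∀ i, ∑ j, φ i j ^ 2 ≤ 1) :
    Real.log (gramMat d k φ k).det ≤ d * Real.log ((k : ℝ) / d + 1) := by
  have hp := gram_posDef d k φ k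
  have ht := gram_trace d k φ hφ
  have hd' : (0 : ℝ) < d := by exact_mod_cast hd
  set m : ℝ := (k : ℝ) / d + 1 with hm
  have hm0 : 0 < m := by positivity
  rw [hp.isHermitian.trace_eq_sum_eigenvalues] at ht
  rw [hp.isHermitian.det_eq_prod_eigenvalues]
  simp only [RCLike.ofReal_real_eq_id, id_eq] at ht ⊢
  rw [Real.log_prod fun i _ => (hp.eigenvalues_pos i).ne']
  have h1 : ∀ i, Real.log (hp.isHermitian.eigenvalues i) ≤
      Real.log m + (hp.isHermitian.eigenvalues i / m - 1) := fun i => by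
    have h := Real.log_le_sub_one_of_pos (div_pos (hp.eigenvalues_pos i) hm0)
    rw [Real.log_div (hp.eigenvalues_pos i).ne' hm0.ne'] at h
    linarith
  refine (Finset.sum_le_sum fun i _ => h1 i).trans ?_
  rw [Finset.sum_add_distrib, Finset.sum_sub_distrib, ← Finset.sum_div]
  simp only [Finset.sum_const, Finset.card_univ, Fintype.card_fin, nsmul_eq_mul, mul_one]
  have h2 : (∑ i, hp.isHermitian.eigenvalues i) / m ≤ d := by
    rw [div_le_iff₀ hm0]
    have : (d : ℝ) * m = d + k := by rw [hm]; field_simp; ring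
    linarith
  linarith

/-- Cumulative bonus bound:
`∑_{i=1}^k sqrt(φ_iᵀ (Λ_{i-1})⁻¹ φ_i) ≤ sqrt(2 d k log(k/d + 1))`. -/
theorem stmt_10 (d k : ℕ) (hd : 0 < d) (hk : 0 < k)
    (φ : Fin k → Fin d → ℝ)
    (hφ : ∀ i : Fin k, Real.sqrt (∑ j, (φ i j) ^ 2) ≤ 1) :
    ∑ i : Fin k, Real.sqrt (φ i ⬝ᵥ (gramMat d k φ (i : ℕ))⁻¹.mulVec (φ i))
      ≤ Real.sqrt (2 * d * k * Real.log ((k : ℝ) / d + 1)) := by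
  have hφ' : ∀ i, ∑ j, φ i j ^ 2 ≤ 1 := fun i => by
    simpa using Real.sqrt_le_iff.mp (hφ i)
  have hx := fun i : Fin k => gram_x d k φ i (φ i) (hφ' i)
  have hstep : ∀ i : Fin k, φ i ⬝ᵥ (gramMat d k φ (i : ℕ))⁻¹.mulVec (φ i) ≤
      2 * (Real.log (gramMat d k φ ((i : ℕ) + 1)).det - Real.log (gramMat d k φ (i : ℕ)).det) := by
    intro i
    obtain ⟨h0, h1⟩ := hx i
    rw [gram_det_succ, Real.log_mul (gram_posDef d k φ i).det_pos.ne' (by positivity)]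
    generalize φ i ⬝ᵥ (gramMat d k φ (i : ℕ))⁻¹.mulVec (φ i) = x at *
    have h := Real.one_sub_inv_le_log_of_pos (show 0 < 1 + x by positivity)
    have h2 : x / 2 ≤ 1 - (1 + x)⁻¹ := by
      have : 1 - (1 + x)⁻¹ = x / (1 + x) := by field_simp; ring
      rw [this]
      exact div_le_div_of_nonneg_left h0 (by positivity) (by linarith)
    linarith
  have hsum : ∑ i : Fin k, φ i ⬝ᵥ (gramMat d k φ (i : ℕ))⁻¹.mulVec (φ i) ≤
      2 * (d * Real.log ((k : ℝ) / d + 1)) := by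
    refine (Finset.sum_le_sum fun i _ => hstep i).trans ?_
    rw [← Finset.mul_sum, Fin.sum_univ_eq_sum_range (fun i =>
      Real.log (gramMat d k φ (i + 1)).det - Real.log (gramMat d k φ i).det),
      Finset.sum_range_sub (fun i => Real.log (gramMat d k φ i).det)]
    have h0 : gramMat d k φ 0 = 1 := by simp [gramMat]
    rw [h0, det_one, Real.log_one, sub_zero]
    linarith [gram_logdet d k hd φ hφ']
  apply Real.le_sqrt_of_sq_le
  refine sq_sum_le_card_mul_sum_sq.trans ?_
  simp only [Finset.card_univ, Fintype.card_fin]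
  rw [Finset.sum_congr rfl fun i _ => Real.sq_sqrt (hx i).1]
  have := mul_le_mul_of_nonneg_left hsum (Nat.cast_nonneg (α := ℝ) k)
  linarith
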